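/- Suppose E[ν ln(ν)] = ∞. Then for GW-almost every tree 𝒯, for UNIF-almost every ray r ∈ S(𝒯), one has limsup_{n→∞} (1/n) ln(W∞(r_n)) = ln(m). -/

import Mathlib

open MeasureTheory Filter Set

noncomputable section

/-- A configuration assigns to each Ulam–Harris label (a finite word on `ℕ`)
a number of children. A Galton–Watson tree is encoded by such a configuration. -/
abbrev Config : Type := List ℕ → ℕ

/-- `v` is a vertex of the tree encoded by the configuration `ω`:
every step of the path from the root is the index of a child of the previous vertex. -/
def memTree (ω : Config) (v : List ℕ) : Prop :=
  ∀ k, (h : k < v.length) → v.get ⟨k, h⟩ < ω (v.take k)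

/-- `Z ω u k` is the number of descendants of the vertex `u` at height `|u| + k`
in the tree encoded by `ω`. -/
def Z (ω : Config) (u : List ℕ) (k : ℕ) : ℕ :=
  Nat.card {v : List ℕ // v.length = k ∧ memTree ω (u ++ v)}

/-- `GW` is the law of the Galton–Watson tree with offspring distribution `q`:
under `GW` the numbers of children attached to the distinct labels
are i.i.d. with distribution `q`. -/
def IsGW (q : ℕ → ℝ) (GW : Measure Config) : Prop :=
  IsProbabilityMeasure GW ∧
    ∀ (S : Finset (List ℕ)) (g : List ℕ → ℕ),
      GW {ω | ∀ u ∈ S, ω u = g u} = ∏ u ∈ S, ENNReal.ofReal (q (g u))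

/-- The probability generating function `φ_n(x) = E[x^{Z_n}]` of the population
at height `n` under the measure `GW`. -/
def pgf (GW : Measure Config) (n : ℕ) (x : ℝ) : ℝ :=
  ∫ ω, x ^ (Z ω [] n) ∂GW

/-- The vertex at height `n` of the ray whose successive child choices are given by `ξ`. -/
def rayVertex (ξ : ℕ → ℕ) (n : ℕ) : List ℕ := List.ofFn (fun i : Fin n => ξ i)

section part1
open scoped ENNReal

/-- shift to the subtree at the `i`-th child -/
def shf (i : ℕ) (ω : Config) : Config := fun v => ω (i :: v)

/-- erase the subtree at the `i`-th child -/
def ers (i : ℕ) (ω : Config) : Config := fun v => if v.head? = some i then 0 else ω v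

def qPMF (q : ℕ → ℝ) (h0 : ∀ ℓ, 0 ≤ q ℓ) (h1 : ∑' ℓ, q ℓ = 1) : PMF ℕ :=
  ⟨fun ℓ => ENNReal.ofReal (q ℓ), by
    have hs : Summable q := by
      by_contra h
      rw [tsum_eq_zero_of_not_summable h] at h1
      exact zero_ne_one h1
    have : ∑' ℓ, ENNReal.ofReal (q ℓ) = 1 := by
      rw [← ENNReal.ofReal_tsum_of_nonneg h0 hs, h1, ENNReal.ofReal_one]
    rw [← this]
    exact ENNReal.summable.hasSum⟩

lemma measurable_shf (i : ℕ) : Measurable (shf i) :=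
  measurable_pi_iff.2 fun v => measurable_pi_apply (i :: v)

lemma measurable_ers (i : ℕ) : Measurable (ers i) := by
  refine measurable_pi_iff.2 fun v => ?_
  unfold ers
  split_ifs
  · exact measurable_const
  · exact measurable_pi_apply v

lemma gw_eq_pi (q : ℕ → ℝ) (h0 : ∀ ℓ, 0 ≤ q ℓ) (h1 : ∑' ℓ, q ℓ = 1)
    (GW : Measure Config) (hGW : IsGW q GW) :
    GW = Measure.infinitePi (fun _ : List ℕ => (qPMF q h0 h1).toMeasure) := by
  have hP := hGW.1
  have hl : IsProjectiveLimit GW (fun I : Finset (List ℕ) =>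
      Measure.pi (fun _ : I => (qPMF q h0 h1).toMeasure)) := by
    intro I
    apply Measure.ext_of_singleton
    intro a
    rw [Measure.map_apply (by fun_prop) (measurableSet_singleton _), Measure.pi_singleton]
    classical
    have := hGW.2 I (fun u => if h : u ∈ I then a ⟨u, h⟩ else 0)
    convert this using 1
    · congr 1
      ext ω
      simp only [mem_preimage, mem_singleton_iff, mem_ofPred_eq, funext_iff, Finset.restrict]
      constructor
      · intro h u hu
        simpa [hu] using h ⟨u, hu⟩
      · intro h u
        simpa using h u u.2
    · rw [← Finset.prod_attach (s := I)]
      simp only [Finset.univ_eq_attach]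
      refine Finset.prod_congr rfl fun u _ => ?_
      rw [PMF.toMeasure_apply_singleton _ _ (measurableSet_singleton _)]
      simp [qPMF]
      rfl
  exact hl.unique (Measure.isProjectiveLimit_infinitePi _)

lemma gw_shift (q : ℕ → ℝ) (h0 : ∀ ℓ, 0 ≤ q ℓ) (h1 : ∑' ℓ, q ℓ = 1)
    (GW : Measure Config) (hGW : IsGW q GW) (i : ℕ) : MeasurePreserving (shf i) GW GW := by
  refine ⟨measurable_shf i, ?_⟩
  rw [gw_eq_pi q h0 h1 GW hGW]
  exact Measure.map_infinitePi_infinitePi_of_inj (P := fun _ : List ℕ => (qPMF q h0 h1).toMeasure)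
    (f := fun v : List ℕ => i :: v) (fun a b h => by simpa using h)

lemma gw_indep (q : ℕ → ℝ) (h0 : ∀ ℓ, 0 ≤ q ℓ) (h1 : ∑' ℓ, q ℓ = 1)
    (GW : Measure Config) (hGW : IsGW q GW) (i : ℕ) :
    ProbabilityTheory.IndepFun (shf i) (ers i) GW := by
  have hi : ProbabilityTheory.iIndepFun (fun (v : List ℕ) (ω : Config) => ω v) GW := by
    rw [gw_eq_pi q h0 h1 GW hGW]
    exact ProbabilityTheory.iIndepFun_infinitePi (X := fun _ (x : ℕ) => x) (fun _ => measurable_id)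
  have hd : Disjoint {v : List ℕ | v.head? = some i} {v : List ℕ | v.head? ≠ some i} :=
    Set.disjoint_left.2 fun v h h' => h' h
  have := ProbabilityTheory.indep_iSup_of_disjoint
    (m := fun v => MeasurableSpace.comap (fun ω : Config => ω v) inferInstance)
    (fun v => (measurable_pi_apply v).comap_le) hi hd
  rw [ProbabilityTheory.IndepFun_iff_Indep]
  refine ProbabilityTheory.indep_of_indep_of_le_left
    (ProbabilityTheory.indep_of_indep_of_le_right this ?_) ?_
  · refine (@measurable_iff_comap_le _ _ (_) _ _).1 ?_
    refine (@measurable_pi_iff _ _ _ (_) _ _).2 fun v => ?_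
    unfold ers
    split_ifs with h
    · exact measurable_const
    · refine Measurable.mono (comap_measurable (fun ω : Config => ω v)) ?_ le_rfl
      exact le_iSup₂_of_le v h le_rfl
  · refine (@measurable_iff_comap_le _ _ (_) _ _).1 ?_
    refine (@measurable_pi_iff _ _ _ (_) _ _).2 fun v => ?_
    refine Measurable.mono (comap_measurable (fun ω : Config => ω (i :: v))) ?_ le_rfl
    exact le_iSup₂_of_le (i :: v) (by simp) le_rfl

lemma gw_lintegral (q : ℕ → ℝ) (h0 : ∀ ℓ, 0 ≤ q ℓ) (h1 : ∑' ℓ, q ℓ = 1)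
    (GW : Measure Config) (hGW : IsGW q GW) (i : ℕ) (f g : Config → ℝ≥0∞)
    (hf : Measurable f) (hg : Measurable g) (hgi : ∀ ω, g (ers i ω) = g ω) :
    ∫⁻ ω, f (shf i ω) * g ω ∂GW = (∫⁻ ω, f ω ∂GW) * ∫⁻ ω, g ω ∂GW := by
  have h := (gw_indep q h0 h1 GW hGW i).comp hf hg
  have h2 := ProbabilityTheory.lintegral_mul_eq_lintegral_mul_lintegral_of_indepFun''
    (hf.comp (measurable_shf i)).aemeasurable (hg.comp (measurable_ers i)).aemeasurable h
  simp only [Function.comp_apply, hgi] at h2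
  rw [h2, (gw_shift q h0 h1 GW hGW i).lintegral_comp hf]

/-- the structure used in the sequel -/
structure Str (GW : Measure Config) (q : ℕ → ℝ) : Prop where
  prob : IsProbabilityMeasure GW
  root : ∀ ℓ, GW {ω | ω [] = ℓ} = ENNReal.ofReal (q ℓ)
  shift : ∀ i, MeasurePreserving (shf i) GW GW
  ind : ∀ (i : ℕ) (f g : Config → ℝ≥0∞), Measurable f → Measurable g →
    (∀ ω, g (ers i ω) = g ω) →
    ∫⁻ ω, f (shf i ω) * g ω ∂GW = (∫⁻ ω, f ω ∂GW) * ∫⁻ ω, g ω ∂GW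

lemma gw_str (q : ℕ → ℝ) (h0 : ∀ ℓ, 0 ≤ q ℓ) (h1 : ∑' ℓ, q ℓ = 1)
    (GW : Measure Config) (hGW : IsGW q GW) : Str GW q where
  prob := hGW.1
  root ℓ := by simpa using hGW.2 {[]} (fun _ => ℓ)
  shift := gw_shift q h0 h1 GW hGW
  ind := gw_lintegral q h0 h1 GW hGW

end part1

section part2
open scoped ENNReal

def Sx (V : Config → ℝ≥0∞) (i : ℕ) (ω : Config) : ℝ≥0∞ :=
  ∑' j, if j < ω [] ∧ j ≠ i then V (shf j ω) else 0

def bI (V : Config → ℝ≥0∞) (i : ℕ) (x : ℝ≥0∞) (ω : Config) : ℝ≥0∞ :=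
  if i < ω [] ∧ Sx V i ω < x then 1 else 0

def gI (V : Config → ℝ≥0∞) (i : ℕ) (x : ℝ≥0∞) (ω : Config) : ℝ≥0∞ :=
  if i < ω [] ∧ x ≤ Sx V i ω then 1 else 0

def Bx (GW : Measure Config) (V : Config → ℝ≥0∞) (x : ℝ≥0∞) : ℝ≥0∞ :=
  ∫⁻ ω, ∑' i, bI V i x ω ∂GW

def Gx (GW : Measure Config) (V : Config → ℝ≥0∞) (x : ℝ≥0∞) : ℝ≥0∞ :=
  ∫⁻ ω, ∑' i, gI V i x ω ∂GW

def Lx (GW : Measure Config) (V : Config → ℝ≥0∞) (x : ℝ≥0∞) : ℝ≥0∞ :=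
  ∫⁻ ω, (if V ω < x then V ω else 0) ∂GW

def Dr (V : Config → ℝ≥0∞) : (ℕ → ℝ≥0∞) → ℕ → Config → ℝ≥0∞
  | thr, 0, ω => if V ω < thr 0 then V ω else 0
  | thr, n + 1, ω => if V ω < thr 0 then
      ∑' i, (if i < ω [] then Dr V (fun k => thr (k + 1)) n (shf i ω) else 0) else 0

lemma ers_root (i : ℕ) (ω : Config) : ers i ω [] = ω [] := by simp [ers]

lemma shf_ers {i j : ℕ} (h : j ≠ i) (ω : Config) : shf j (ers i ω) = shf j ω := by
  funext v; simp [shf, ers, h]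

lemma Sx_ers (V : Config → ℝ≥0∞) (i : ℕ) (ω : Config) : Sx V i (ers i ω) = Sx V i ω := by
  unfold Sx
  refine tsum_congr fun j => ?_
  by_cases h : j = i
  · simp [h]
  · rw [ers_root, shf_ers h]

lemma meas_lt (i : ℕ) : MeasurableSet {ω : Config | i < ω []} :=
  measurableSet_lt measurable_const (measurable_pi_apply _)

variable {GW : Measure Config} {q : ℕ → ℝ} {V : Config → ℝ≥0∞}

lemma meas_Sx (hV : Measurable V) (i : ℕ) : Measurable (Sx V i) := by
  refine Measurable.tsum fun j => ?_
  refine Measurable.ite ?_ (hV.comp (measurable_shf j)) measurable_const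
  by_cases h : j = i
  · simp [h]
  · simpa [h] using meas_lt j

lemma meas_bI (hV : Measurable V) (i : ℕ) (x : ℝ≥0∞) : Measurable (bI V i x) :=
  Measurable.ite ((meas_lt i).inter (measurableSet_lt (meas_Sx hV i) measurable_const))
    measurable_const measurable_const

lemma meas_gI (hV : Measurable V) (i : ℕ) (x : ℝ≥0∞) : Measurable (gI V i x) :=
  Measurable.ite ((meas_lt i).inter (measurableSet_le measurable_const (meas_Sx hV i)))
    measurable_const measurable_const

lemma meas_Dr (hV : Measurable V) (n : ℕ) : ∀ thr, Measurable (Dr V thr n) := by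
  induction n with
  | zero =>
    intro thr
    exact Measurable.ite (measurableSet_lt hV measurable_const) hV measurable_const
  | succ n ih =>
    intro thr
    refine Measurable.ite (measurableSet_lt hV measurable_const) ?_ measurable_const
    refine Measurable.tsum fun j => ?_
    exact Measurable.ite (meas_lt j) ((ih _).comp (measurable_shf j)) measurable_const

/-- splitting off one child -/
lemma split_child {i : ℕ} {ω : Config} (h : i < ω []) :
    ∑' j, (if j < ω [] then V (shf j ω) else 0) = V (shf i ω) + Sx V i ω := by
  rw [ENNReal.tsum_eq_add_tsum_ite i]
  simp only [h, if_true]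
  congr 1
  unfold Sx
  refine tsum_congr fun j => ?_
  by_cases hj : j = i <;> simp [hj]

/-- many-to-one -/
lemma many_one (hS : Str GW q) (hV : Measurable V) (f : Config → ℝ≥0∞) (hf : Measurable f)
    (x : ℝ≥0∞) :
    ∫⁻ ω, ∑' i, f (shf i ω) * bI V i x ω ∂GW = (∫⁻ ω, f ω ∂GW) * Bx GW V x := by
  unfold Bx
  rw [lintegral_tsum (f := fun i ω => f (shf i ω) * bI V i x ω)
    (fun i => ((hf.comp (measurable_shf i)).mul (meas_bI hV i x)).aemeasurable),
    lintegral_tsum (fun i => (meas_bI hV i x).aemeasurable), ← ENNReal.tsum_mul_left]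
  refine tsum_congr fun i => ?_
  refine hS.ind i f _ hf (meas_bI hV i x) fun ω => ?_
  unfold bI
  rw [Sx_ers, ers_root]

variable {M : ℝ≥0∞}

lemma D_step (hS : Str GW q) (hV : Measurable V) (hM0 : M ≠ 0) (hMt : M ≠ ⊤)
    (hrec : ∀ᵐ ω ∂GW, M * V ω = ∑' i, if i < ω [] then V (shf i ω) else 0)
    (thr : ℕ → ℝ≥0∞) (n : ℕ) :
    ∫⁻ ω, Dr V thr (n + 1) ω ∂GW ≤
      (∫⁻ ω, Dr V (fun k => thr (k + 1)) n ω ∂GW) * Bx GW V (M * thr 0) := by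
  rw [← many_one hS hV _ (meas_Dr hV n _)]
  refine lintegral_mono_ae ?_
  filter_upwards [hrec] with ω hω
  simp only [Dr]
  split_ifs with h
  · refine ENNReal.tsum_le_tsum fun i => ?_
    split_ifs with hi
    · have : Sx V i ω < M * thr 0 := by
        calc Sx V i ω ≤ M * V ω := by rw [hω, split_child hi]; exact le_add_self
          _ < M * thr 0 := (ENNReal.mul_lt_mul_iff_right hM0 hMt).2 h
      simp [bI, hi, this]
    · exact zero_le
  · exact zero_le

lemma L_step (hS : Str GW q) (hV : Measurable V) (hM0 : M ≠ 0) (hMt : M ≠ ⊤)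
    (hrec : ∀ᵐ ω ∂GW, M * V ω = ∑' i, if i < ω [] then V (shf i ω) else 0)
    (x y z : ℝ≥0∞) (h : y + z ≤ M * x) :
    Lx GW V y * Bx GW V z ≤ M * Lx GW V x := by
  unfold Lx
  rw [← many_one hS hV (fun ω => if V ω < y then V ω else 0)
    (Measurable.ite (measurableSet_lt hV measurable_const) hV measurable_const),
    ← lintegral_const_mul _ (Measurable.ite (measurableSet_lt hV measurable_const) hV
      measurable_const)]
  refine lintegral_mono_ae ?_
  filter_upwards [hrec] with ω hω
  by_cases hx : V ω < x
  · rw [if_pos hx, hω]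
    refine ENNReal.tsum_le_tsum fun i => ?_
    unfold bI
    split_ifs <;> simp_all
  · rw [if_neg hx, mul_zero, nonpos_iff_eq_zero, ENNReal.tsum_eq_zero]
    intro i
    by_contra hne
    apply hx
    unfold bI at hne
    have h1 : V (shf i ω) < y := by
      by_contra h'
      simp [h'] at hne
    have h2 : i < ω [] ∧ Sx V i ω < z := by
      by_contra h'
      simp [h'] at hne
    refine (ENNReal.mul_lt_mul_iff_right hM0 hMt).1 (lt_of_lt_of_le ?_ h)
    rw [hω, split_child h2.1]
    exact ENNReal.add_lt_add h1 h2.2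

lemma Bx_mono {x y : ℝ≥0∞} (h : x ≤ y) : Bx GW V x ≤ Bx GW V y := by
  refine lintegral_mono fun ω => ENNReal.tsum_le_tsum fun i => ?_
  unfold bI
  split_ifs with h1 h2
  · exact le_rfl
  · exact absurd ⟨h1.1, h1.2.trans_le h⟩ h2
  · exact zero_le
  · exact le_rfl

lemma BG (hV : Measurable V) (x : ℝ≥0∞) :
    Bx GW V x + Gx GW V x = ∫⁻ ω, (ω [] : ℝ≥0∞) ∂GW := by
  unfold Bx Gx
  rw [← lintegral_add_left (Measurable.tsum fun i => meas_bI hV i x)]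
  refine lintegral_congr fun ω => ?_
  rw [← ENNReal.tsum_add]
  have : ∀ i, bI V i x ω + gI V i x ω = if i ∈ Finset.range (ω []) then 1 else 0 := by
    intro i
    unfold bI gI
    by_cases h1 : i < ω [] <;> by_cases h2 : Sx V i ω < x <;> simp [h1, h2]
  simp_rw [this]
  rw [tsum_eq_sum (s := Finset.range (ω [])) (by intro i hi; simp only [hi, if_false]),
    Finset.sum_congr rfl (fun i hi => if_pos hi)]
  simp

lemma mean_eq (hS : Str GW q) (h0 : ∀ ℓ, 0 ≤ q ℓ) {m : ℝ} (hm : 0 < m)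
    (hmd : m = ∑' ℓ : ℕ, (ℓ : ℝ) * q ℓ) :
    ∫⁻ ω, (ω [] : ℝ≥0∞) ∂GW = ENNReal.ofReal m := by
  have hs : Summable (fun ℓ : ℕ => (ℓ : ℝ) * q ℓ) := by
    by_contra h
    rw [tsum_eq_zero_of_not_summable h] at hmd
    exact hm.ne' hmd
  rw [hmd, ENNReal.ofReal_tsum_of_nonneg (fun ℓ => mul_nonneg (Nat.cast_nonneg _) (h0 ℓ)) hs]
  have : Measurable (fun ω : Config => ω []) := measurable_pi_apply _
  rw [← lintegral_map (f := fun n : ℕ => (n : ℝ≥0∞)) (measurable_from_top) this,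
    lintegral_countable']
  refine tsum_congr fun ℓ => ?_
  rw [Measure.map_apply this (measurableSet_singleton _), ENNReal.ofReal_mul (Nat.cast_nonneg _),
    ENNReal.ofReal_natCast, ← hS.root]
  rfl

end part2

section part3
open scoped ENNReal

variable {GW : Measure Config} {q : ℕ → ℝ} {V : Config → ℝ≥0∞}

lemma meas_root (ℓ : ℕ) : MeasurableSet {ω : Config | ω [] = ℓ} :=
  (measurable_pi_apply (X := fun _ : List ℕ => ℕ) []) (measurableSet_singleton ℓ)

lemma e_le (hS : Str GW q) : ∫⁻ ω, min (V ω) 1 ∂GW ≤ 1 := by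
  have := hS.prob
  calc ∫⁻ ω, min (V ω) 1 ∂GW ≤ ∫⁻ _, 1 ∂GW := lintegral_mono fun ω => min_le_right _ _
    _ = 1 := by simp

lemma tail_one (hS : Str GW q) (hV : Measurable V) (e : ℝ≥0∞) (he : e = ∫⁻ ω, min (V ω) 1 ∂GW)
    (ℓ i : ℕ) (hℓ : 2 ≤ ℓ) (hi : i < ℓ) (x : ℝ≥0∞) (hx : x ≤ ((ℓ - 1 : ℕ) : ℝ≥0∞) * (e / 2)) :
    ENNReal.ofReal (q ℓ) * (e / 2) ≤ ∫⁻ ω, (if ω [] = ℓ then 1 else 0) * gI V i x ω ∂GW := by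
  have he1 : e ≤ 1 := he ▸ e_le hS
  have het : e ≠ ⊤ := ne_top_of_le_ne_top ENNReal.one_ne_top he1
  set I : Config → ℝ≥0∞ := fun ω => if ω [] = ℓ then 1 else 0 with hI
  have hIm : Measurable I := Measurable.ite (meas_root ℓ) measurable_const measurable_const
  have hIint : ∫⁻ ω, I ω ∂GW = ENNReal.ofReal (q ℓ) := by
    rw [← hS.root ℓ, ← lintegral_indicator_one (meas_root ℓ)]
    refine lintegral_congr fun ω => ?_
    simp [hI, Set.indicator_apply]
  set s := (Finset.range ℓ).erase i with hs
  have hcard : s.card = ℓ - 1 := by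
    rw [hs, Finset.card_erase_of_mem (Finset.mem_range.2 hi), Finset.card_range]
  have hLHS : ∫⁻ ω, ∑ j ∈ s, min (V (shf j ω)) 1 * I ω ∂GW
      = ((ℓ - 1 : ℕ) : ℝ≥0∞) * (e * ENNReal.ofReal (q ℓ)) := by
    rw [lintegral_finsetSum' (f := fun j ω => min (V (shf j ω)) 1 * I ω) _ (fun j _ => ((((hV.comp (measurable_shf j)).min
      measurable_const)).mul hIm).aemeasurable)]
    rw [Finset.sum_congr rfl (fun j _ => hS.ind j (fun ω => min (V ω) 1) I
      (hV.min measurable_const) hIm (fun ω => by simp [hI, ers_root]))]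
    rw [Finset.sum_const, hcard, nsmul_eq_mul, ← he, hIint]
  have hpt : ∀ ω, ∑ j ∈ s, min (V (shf j ω)) 1 * I ω
      ≤ x * I ω + ((ℓ - 1 : ℕ) : ℝ≥0∞) * (I ω * gI V i x ω) := by
    intro ω
    by_cases h : ω [] = ℓ
    · simp only [hI, h, if_true, mul_one, one_mul]
      by_cases hx' : x ≤ Sx V i ω
      · refine le_trans ?_ le_add_self
        simp only [gI, h, hi, hx', and_self, if_true, mul_one]
        calc ∑ j ∈ s, min (V (shf j ω)) 1 ≤ ∑ j ∈ s, 1 :=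
              Finset.sum_le_sum fun j _ => min_le_right _ _
          _ = _ := by simp [hcard]
      · refine le_trans ?_ le_self_add
        refine le_trans ?_ (not_le.1 hx').le
        unfold Sx
        refine le_trans (Finset.sum_le_sum fun j hj => ?_) (ENNReal.sum_le_tsum s)
        have hj' := Finset.mem_erase.1 hj
        rw [if_pos ⟨by rw [h]; exact Finset.mem_range.1 hj'.2, hj'.1⟩]
        exact min_le_left _ _
    · simp [hI, h]
  have hint := lintegral_mono (μ := GW) hpt
  rw [hLHS, lintegral_add_left (hIm.const_mul x), lintegral_const_mul _ hIm,
    lintegral_const_mul (f := fun ω => I ω * gI V i x ω) _ (hIm.mul (meas_gI hV i x)),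
    hIint] at hint
  set P := ∫⁻ ω, I ω * gI V i x ω ∂GW
  set Q := ENNReal.ofReal (q ℓ)
  set n := ((ℓ - 1 : ℕ) : ℝ≥0∞) with hn
  have hn0 : n ≠ 0 := Nat.cast_ne_zero.2 (by omega)
  have hnt : n ≠ ⊤ := ENNReal.natCast_ne_top _
  have h1 : n * (e / 2 * Q) + n * (e / 2 * Q) ≤ n * (e / 2 * Q) + n * P := by
    calc n * (e / 2 * Q) + n * (e / 2 * Q) = n * (e * Q) := by
          rw [← mul_add, ← add_mul, ENNReal.add_halves]
      _ ≤ x * Q + n * P := hint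
      _ ≤ n * (e / 2) * Q + n * P := by gcongr
      _ = _ := by rw [mul_assoc]
  have hfin : n * (e / 2 * Q) ≠ ⊤ :=
    ENNReal.mul_ne_top hnt (ENNReal.mul_ne_top (ENNReal.div_ne_top het (by simp))
      ENNReal.ofReal_ne_top)
  have h2 := (ENNReal.add_le_add_iff_left hfin).1 h1
  rw [mul_comm]
  exact (ENNReal.mul_le_mul_iff_right hn0 hnt).1 h2

lemma Gx_lower (hS : Str GW q) (hV : Measurable V) (e : ℝ≥0∞)
    (he : e = ∫⁻ ω, min (V ω) 1 ∂GW) (x : ℝ≥0∞) :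
    ∑' ℓ : ℕ, (if 2 ≤ ℓ ∧ x ≤ ((ℓ - 1 : ℕ) : ℝ≥0∞) * (e / 2) then
      (ℓ : ℝ≥0∞) * (ENNReal.ofReal (q ℓ) * (e / 2)) else 0) ≤ Gx GW V x := by
  have hIm : ∀ ℓ : ℕ, Measurable (fun ω : Config => if ω [] = ℓ then (1 : ℝ≥0∞) else 0) :=
    fun ℓ => Measurable.ite (meas_root ℓ) measurable_const measurable_const
  have key : Gx GW V x = ∑' ℓ : ℕ, ∑' i, ∫⁻ ω, (if ω [] = ℓ then 1 else 0) * gI V i x ω ∂GW := by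
    unfold Gx
    rw [lintegral_tsum (fun i => (meas_gI hV i x).aemeasurable), ENNReal.tsum_comm]
    refine tsum_congr fun i => ?_
    rw [← lintegral_tsum (f := fun ℓ ω => (if ω [] = ℓ then 1 else 0) * gI V i x ω)
      (fun ℓ => ((hIm ℓ).mul (meas_gI hV i x)).aemeasurable)]
    refine lintegral_congr fun ω => ?_
    rw [ENNReal.tsum_mul_right]
    rw [tsum_eq_single (ω []) (by intro b hb; simp [hb.symm])]
    simp
  rw [key]
  refine ENNReal.tsum_le_tsum fun ℓ => ?_
  split_ifs with h
  · refine le_trans ?_ (ENNReal.sum_le_tsum (Finset.range ℓ))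
    calc (ℓ : ℝ≥0∞) * (ENNReal.ofReal (q ℓ) * (e / 2))
        = ∑ i ∈ Finset.range ℓ, (ENNReal.ofReal (q ℓ) * (e / 2)) := by simp
      _ ≤ _ := Finset.sum_le_sum fun i hi =>
          tail_one hS hV e he ℓ i h.1 (Finset.mem_range.1 hi) x h.2
  · exact zero_le

lemma count_lower (e : ℝ) (he : 0 < e) (C ρ : ℝ) (hC : 0 < C) (hρ : 1 < ρ) (ℓ : ℕ) :
    ENNReal.ofReal (Real.log ℓ) ≤ ENNReal.ofReal (Real.log ρ) *
      (∑' i : ℕ, if 2 ≤ ℓ ∧ ENNReal.ofReal (C * ρ ^ i) ≤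
        ((ℓ - 1 : ℕ) : ℝ≥0∞) * (ENNReal.ofReal e / 2) then (1 : ℝ≥0∞) else 0)
      + ENNReal.ofReal (Real.log (4 * C / e)) := by
  by_cases hℓ : 2 ≤ ℓ
  swap
  · have : ℓ = 0 ∨ ℓ = 1 := by omega
    rcases this with rfl | rfl <;> simp
  have hlr := Real.log_pos hρ
  set K := Real.log (4 * C / e) with hK
  set n := ⌈(Real.log ℓ - K) / Real.log ρ⌉₊ with hn
  have hsum : (n : ℝ≥0∞) ≤ ∑' i : ℕ, if 2 ≤ ℓ ∧ ENNReal.ofReal (C * ρ ^ i) ≤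
        ((ℓ - 1 : ℕ) : ℝ≥0∞) * (ENNReal.ofReal e / 2) then (1 : ℝ≥0∞) else 0 := by
    calc (n : ℝ≥0∞) = ∑ i ∈ Finset.range n, 1 := by simp
      _ ≤ _ := Finset.sum_le_sum (fun i hi => ?_)
      _ ≤ _ := ENNReal.sum_le_tsum (Finset.range n)
    rw [if_pos]
    refine ⟨hℓ, ?_⟩
    have hi' : (i : ℝ) < (Real.log ℓ - K) / Real.log ρ := Nat.lt_ceil.1 (Finset.mem_range.1 hi)
    rw [lt_div_iff₀ hlr] at hi'
    have hℓ0 : (0 : ℝ) < ℓ := by positivity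
    have h1 : ρ ^ i * (4 * C / e) ≤ ℓ := by
      rw [← Real.log_le_log_iff (by positivity) hℓ0, Real.log_mul (by positivity) (by positivity),
        Real.log_pow]
      linarith
    have h2 : (ℓ : ℝ) ≤ 2 * ((ℓ - 1 : ℕ) : ℝ) := by
      have : ℓ ≤ 2 * (ℓ - 1) := by omega
      exact_mod_cast this
    have h3 : C * ρ ^ i ≤ ((ℓ - 1 : ℕ) : ℝ) * (e / 2) := by
      have h4 : ρ ^ i * (4 * C / e) = 4 * (C * ρ ^ i) / e := by ring
      rw [h4, div_le_iff₀ he] at h1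
      nlinarith
    calc ENNReal.ofReal (C * ρ ^ i) ≤ ENNReal.ofReal (((ℓ - 1 : ℕ) : ℝ) * (e / 2)) :=
          ENNReal.ofReal_le_ofReal h3
      _ = _ := by
          rw [ENNReal.ofReal_mul (Nat.cast_nonneg _), ENNReal.ofReal_natCast,
            ENNReal.ofReal_div_of_pos (by norm_num)]
          simp
  refine le_trans ?_ (add_le_add (mul_le_mul_right hsum _) le_rfl)
  rw [← ENNReal.ofReal_natCast, ← ENNReal.ofReal_mul hlr.le]
  refine le_trans (ENNReal.ofReal_le_ofReal ?_) ENNReal.ofReal_add_le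
  have := Nat.le_ceil ((Real.log ℓ - K) / Real.log ρ)
  rw [← hn, div_le_iff₀ hlr] at this
  linarith

lemma Gx_sum (hS : Str GW q) (hV : Measurable V) (h0 : ∀ ℓ, 0 ≤ q ℓ)
    (hpos : ∀ᵐ ω ∂GW, 0 < V ω) {m : ℝ} (hm : 0 < m)
    (hmd : m = ∑' ℓ : ℕ, (ℓ : ℝ) * q ℓ)
    (hX : ∑' ℓ : ℕ, ENNReal.ofReal (q ℓ * (ℓ : ℝ) * Real.log ℓ) = ⊤)
    (C ρ : ℝ) (hC : 0 < C) (hρ : 1 < ρ) :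
    ∑' i : ℕ, Gx GW V (ENNReal.ofReal (C * ρ ^ i)) = ⊤ := by
  have hP := hS.prob
  obtain ⟨e, he⟩ : ∃ e, e = ∫⁻ ω, min (V ω) 1 ∂GW := ⟨_, rfl⟩
  have he1 : e ≤ 1 := he ▸ e_le hS
  have het : e ≠ ⊤ := ne_top_of_le_ne_top ENNReal.one_ne_top he1
  have he0 : e ≠ 0 := by
    intro h
    rw [h] at he
    have h1 := (lintegral_eq_zero_iff (hV.min measurable_const)).1 he.symm
    have : ∀ᵐ ω ∂GW, False := by
      filter_upwards [h1, hpos] with ω h1 h2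
      simp only [Pi.zero_apply] at h1
      rcases min_eq_iff.1 h1 with h | h
      · exact h2.ne' h.1
      · exact one_ne_zero h.1
    have h3 := this.exists
    simp at h3
  set cnt : ℕ → ℝ≥0∞ := fun ℓ => ∑' i : ℕ, if 2 ≤ ℓ ∧ ENNReal.ofReal (C * ρ ^ i) ≤
        ((ℓ - 1 : ℕ) : ℝ≥0∞) * (e / 2) then (1 : ℝ≥0∞) else 0 with hcnt
  have hlow : (∑' ℓ : ℕ, (ℓ : ℝ≥0∞) * ENNReal.ofReal (q ℓ) * cnt ℓ) * (e / 2)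
      ≤ ∑' i : ℕ, Gx GW V (ENNReal.ofReal (C * ρ ^ i)) := by
    refine le_trans (le_of_eq ?_) (ENNReal.tsum_le_tsum fun i =>
      Gx_lower hS hV e he (ENNReal.ofReal (C * ρ ^ i)))
    rw [ENNReal.tsum_comm, ← ENNReal.tsum_mul_right]
    refine tsum_congr fun ℓ => ?_
    simp only [hcnt]
    rw [mul_assoc, ← ENNReal.tsum_mul_right, ← ENNReal.tsum_mul_left]
    refine tsum_congr fun i => ?_
    split_ifs
    · rw [one_mul, mul_assoc]
    · simp
  have hmean : ∑' ℓ : ℕ, (ℓ : ℝ≥0∞) * ENNReal.ofReal (q ℓ) = ENNReal.ofReal m := by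
    have hs : Summable (fun ℓ : ℕ => (ℓ : ℝ) * q ℓ) := by
      by_contra h
      rw [tsum_eq_zero_of_not_summable h] at hmd
      exact hm.ne' hmd
    rw [hmd, ENNReal.ofReal_tsum_of_nonneg (fun ℓ => mul_nonneg (Nat.cast_nonneg _) (h0 ℓ)) hs]
    refine tsum_congr fun ℓ => ?_
    rw [ENNReal.ofReal_mul (Nat.cast_nonneg _), ENNReal.ofReal_natCast]
  have hup : (⊤ : ℝ≥0∞) ≤ (∑' ℓ : ℕ, (ℓ : ℝ≥0∞) * ENNReal.ofReal (q ℓ) * cnt ℓ)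
      * ENNReal.ofReal (Real.log ρ) +
      ENNReal.ofReal m * ENNReal.ofReal (Real.log (4 * C / e.toReal)) := by
    rw [← hX, ← hmean, ← ENNReal.tsum_mul_right, ← ENNReal.tsum_mul_right, ← ENNReal.tsum_add]
    refine ENNReal.tsum_le_tsum fun ℓ => ?_
    have h := count_lower e.toReal (ENNReal.toReal_pos he0 het) C ρ hC hρ ℓ
    rw [ENNReal.ofReal_toReal het] at h
    rw [ENNReal.ofReal_mul (mul_nonneg (h0 ℓ) (Nat.cast_nonneg _)), ENNReal.ofReal_mul (h0 ℓ),
      ENNReal.ofReal_natCast]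
    calc _ ≤ ENNReal.ofReal (q ℓ) * (ℓ : ℝ≥0∞) * (ENNReal.ofReal (Real.log ρ) * cnt ℓ
          + ENNReal.ofReal (Real.log (4 * C / e.toReal))) := mul_le_mul_right h _
      _ = _ := by ring
  have hT : ∑' ℓ : ℕ, (ℓ : ℝ≥0∞) * ENNReal.ofReal (q ℓ) * cnt ℓ = ⊤ := by
    by_contra hne
    exact absurd (top_le_iff.1 hup) (ENNReal.add_ne_top.2
      ⟨ENNReal.mul_ne_top hne ENNReal.ofReal_ne_top,
        ENNReal.mul_ne_top ENNReal.ofReal_ne_top ENNReal.ofReal_ne_top⟩)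
  rw [hT, ENNReal.top_mul (ENNReal.div_pos he0 (by simp)).ne'] at hlow
  exact top_le_iff.1 hlow

lemma prod_zero (b g : ℕ → ℝ≥0∞) (M : ℝ≥0∞) (hM0 : M ≠ 0) (hMt : M ≠ ⊤)
    (h : ∀ i, b i + g i = M) (hg : ∑' i, g i = ⊤) :
    Tendsto (fun n => ∏ i ∈ Finset.range n, (b i / M)) atTop (nhds 0) := by
  have hgt : ∀ i, g i / M ≠ ⊤ := fun i =>
    ENNReal.div_ne_top (ne_top_of_le_ne_top hMt (h i ▸ le_add_self)) hM0
  have h1 : ∀ i, b i / M ≤ ENNReal.ofReal (Real.exp (-(g i / M).toReal)) := by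
    intro i
    have h2 : b i / M + g i / M = 1 := by
      rw [← ENNReal.add_div, h i, ENNReal.div_self hM0 hMt]
    have h3 : b i / M ≠ ⊤ := ne_top_of_le_ne_top ENNReal.one_ne_top (h2 ▸ le_self_add)
    rw [← ENNReal.ofReal_toReal h3]
    apply ENNReal.ofReal_le_ofReal
    have h4 := congrArg ENNReal.toReal h2
    rw [ENNReal.toReal_add h3 (hgt i), ENNReal.toReal_one] at h4
    have := Real.add_one_le_exp (-(g i / M).toReal)
    linarith
  set S : ℕ → ℝ≥0∞ := fun n => ∑ i ∈ Finset.range n, g i / M with hSd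
  have hSt : ∀ n, S n ≠ ⊤ := fun n => ENNReal.sum_ne_top.2 fun i _ => hgt i
  have hS : Tendsto S atTop (nhds ⊤) := by
    have h5 : ∑' i, g i / M = ⊤ := by
      simp_rw [div_eq_mul_inv]
      rw [ENNReal.tsum_mul_right, hg, ENNReal.top_mul (ENNReal.inv_ne_zero.2 hMt)]
    rw [← h5]
    exact ENNReal.tendsto_nat_tsum _
  have hS' : Tendsto (fun n => (S n).toReal) atTop atTop := by
    rw [tendsto_atTop]
    intro r
    filter_upwards [hS.eventually (lt_mem_nhds (ENNReal.ofReal_lt_top (r := r)))] with n hn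
    exact (ENNReal.ofReal_le_iff_le_toReal (hSt n)).1 hn.le
  have hlim : Tendsto (fun n => ENNReal.ofReal (Real.exp (-(S n).toReal))) atTop (nhds 0) := by
    rw [← ENNReal.ofReal_zero]
    exact ENNReal.tendsto_ofReal (Real.tendsto_exp_neg_atTop_nhds_zero.comp hS')
  refine tendsto_of_tendsto_of_tendsto_of_le_of_le tendsto_const_nhds hlim
    (fun n => zero_le) (fun n => ?_)
  calc ∏ i ∈ Finset.range n, (b i / M)
      ≤ ∏ i ∈ Finset.range n, ENNReal.ofReal (Real.exp (-(g i / M).toReal)) :=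
        Finset.prod_le_prod' fun i _ => h1 i
    _ = _ := by
      rw [← ENNReal.ofReal_prod_of_nonneg (fun i _ => (Real.exp_pos _).le), ← Real.exp_sum,
        ENNReal.toReal_sum (fun i _ => hgt i), Finset.sum_neg_distrib]

end part3

section part4
open scoped ENNReal

variable {GW : Measure Config} {q : ℕ → ℝ} {V : Config → ℝ≥0∞}

def thr (θ : ℝ) (k0 : ℕ) : ℕ → ℝ≥0∞ := fun k => ENNReal.ofReal (θ ^ (k0 + k))

lemma thr_succ (θ : ℝ) (k0 : ℕ) : (fun k => thr θ k0 (k + 1)) = thr θ (k0 + 1) := by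
  funext k
  simp only [thr]
  congr 2
  omega

def bet (GW : Measure Config) (V : Config → ℝ≥0∞) (M : ℝ≥0∞) (θ : ℝ) (k : ℕ) : ℝ≥0∞ :=
  Bx GW V (M * ENNReal.ofReal (θ ^ k)) / M

lemma E_bound {M : ℝ≥0∞} (hS : Str GW q) (hV : Measurable V) (hM0 : M ≠ 0) (hMt : M ≠ ⊤)
    (hrec : ∀ᵐ ω ∂GW, M * V ω = ∑' i, if i < ω [] then V (shf i ω) else 0)
    (θ : ℝ) (n : ℕ) : ∀ k0, (∫⁻ ω, Dr V (thr θ k0) n ω ∂GW) / M ^ n ≤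
      Lx GW V (ENNReal.ofReal (θ ^ (k0 + n))) * ∏ k ∈ Finset.range n, bet GW V M θ (k0 + k) := by
  induction n with
  | zero => intro k0; simp [Dr, Lx, thr]
  | succ n ih =>
    intro k0
    have h := D_step hS hV hM0 hMt hrec (thr θ k0) n
    rw [thr_succ] at h
    have h2 := ih (k0 + 1)
    calc (∫⁻ ω, Dr V (thr θ k0) (n + 1) ω ∂GW) / M ^ (n + 1)
        ≤ ((∫⁻ ω, Dr V (thr θ (k0 + 1)) n ω ∂GW) * Bx GW V (M * thr θ k0 0)) / M ^ (n + 1) := by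
          gcongr
      _ = ((∫⁻ ω, Dr V (thr θ (k0 + 1)) n ω ∂GW) / M ^ n) * (Bx GW V (M * thr θ k0 0) / M) := by
          rw [pow_succ, div_eq_mul_inv, div_eq_mul_inv, div_eq_mul_inv,
            ENNReal.mul_inv (Or.inr hMt) (Or.inr hM0)]
          ring
      _ ≤ (Lx GW V (ENNReal.ofReal (θ ^ (k0 + 1 + n))) *
            ∏ k ∈ Finset.range n, bet GW V M θ (k0 + 1 + k)) * bet GW V M θ k0 := by
          refine mul_le_mul' h2 (le_of_eq ?_)
          simp [bet, thr]
      _ = _ := by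
          have e1 : k0 + 1 + n = k0 + (n + 1) := by omega
          have e2 : ∀ k, k0 + 1 + k = k0 + (k + 1) := fun k => by omega
          rw [Finset.prod_range_succ', mul_assoc, e1]
          simp only [e2, add_zero]

lemma L_iter {m : ℝ} (hm : 0 < m) (hS : Str GW q) (hV : Measurable V)
    (hrec : ∀ᵐ ω ∂GW, ENNReal.ofReal m * V ω = ∑' i, if i < ω [] then V (shf i ω) else 0)
    (lam : ℝ) (hl0 : 0 < lam) (hlm : lam < m) (j : ℕ) (b : ℕ → ℝ≥0∞) (n : ℕ)
    (hb : ∀ u < n, b u ≤ Bx GW V (ENNReal.ofReal ((m - lam) * lam ^ (j + u))) / ENNReal.ofReal m) :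
    Lx GW V (ENNReal.ofReal (lam ^ (j + n))) * ∏ u ∈ Finset.range n, b u
      ≤ Lx GW V (ENNReal.ofReal (lam ^ j)) := by
  have hM0 : ENNReal.ofReal m ≠ 0 := by simpa using hm
  have hMt : ENNReal.ofReal m ≠ ⊤ := ENNReal.ofReal_ne_top
  induction n with
  | zero => simp
  | succ n ih =>
    have h1 := L_step hS hV hM0 hMt hrec (ENNReal.ofReal (lam ^ (j + n)))
      (ENNReal.ofReal (lam ^ (j + n + 1))) (ENNReal.ofReal ((m - lam) * lam ^ (j + n))) (by
        rw [← ENNReal.ofReal_mul hm.le, ← ENNReal.ofReal_add (by positivity)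
          (mul_nonneg (by linarith) (by positivity))]
        apply le_of_eq
        congr 1
        ring)
    have h2 : Lx GW V (ENNReal.ofReal (lam ^ (j + (n + 1)))) * b n
        ≤ Lx GW V (ENNReal.ofReal (lam ^ (j + n))) := by
      calc _ ≤ Lx GW V (ENNReal.ofReal (lam ^ (j + n + 1))) *
            (Bx GW V (ENNReal.ofReal ((m - lam) * lam ^ (j + n))) / ENNReal.ofReal m) :=
            mul_le_mul' le_rfl (hb n (Nat.lt_succ_self n))
        _ ≤ _ := by
            rw [← mul_div_assoc]
            exact ENNReal.div_le_of_le_mul' h1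
    calc _ = (Lx GW V (ENNReal.ofReal (lam ^ (j + (n + 1)))) * b n) *
          ∏ u ∈ Finset.range n, b u := by rw [Finset.prod_range_succ]; ring
      _ ≤ _ := le_trans (mul_le_mul' h2 le_rfl) (ih fun u hu => hb u (by omega))

lemma Lx_fin (hS : Str GW q) (x : ℝ) : Lx GW V (ENNReal.ofReal x) ≠ ⊤ := by
  have := hS.prob
  refine ne_top_of_le_ne_top (ENNReal.ofReal_ne_top (r := x)) ?_
  calc Lx GW V (ENNReal.ofReal x) ≤ ∫⁻ _, ENNReal.ofReal x ∂GW := by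
        refine lintegral_mono fun ω => ?_
        dsimp only
        split_ifs with h
        · exact h.le
        · exact zero_le
    _ = _ := by simp

lemma bet_le_one {m : ℝ} (hm : 0 < m) (hV : Measurable V)
    (hmean : ∫⁻ ω, (ω [] : ℝ≥0∞) ∂GW = ENNReal.ofReal m) (θ : ℝ) (k : ℕ) :
    bet GW V (ENNReal.ofReal m) θ k ≤ 1 := by
  unfold bet
  refine ENNReal.div_le_of_le_mul' ?_
  calc _ ≤ Bx GW V (ENNReal.ofReal m * ENNReal.ofReal (θ ^ k)) +
        Gx GW V (ENNReal.ofReal m * ENNReal.ofReal (θ ^ k)) := le_self_add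
    _ = _ := by rw [BG hV, hmean, mul_one]

lemma decay {m : ℝ} (hm : 1 < m) (hS : Str GW q) (hV : Measurable V) (h0 : ∀ ℓ, 0 ≤ q ℓ)
    (hrec : ∀ᵐ ω ∂GW, ENNReal.ofReal m * V ω = ∑' i, if i < ω [] then V (shf i ω) else 0)
    (hpos : ∀ᵐ ω ∂GW, 0 < V ω)
    (hmd : m = ∑' ℓ : ℕ, (ℓ : ℝ) * q ℓ)
    (hX : ∑' ℓ : ℕ, ENNReal.ofReal (q ℓ * (ℓ : ℝ) * Real.log ℓ) = ⊤)
    (p : ℕ) (hp : 1 ≤ p) (τ : ℝ) (hτ : 1 < τ) (hτm : τ ^ (p + 1) < m) (i0 : ℕ) :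
    ∀ᵐ ω ∂GW, ⨅ n, Dr V (thr (τ ^ p) ((p + 1) * i0)) n ω / ENNReal.ofReal m ^ n = 0 := by
  have hm0 : 0 < m := by linarith
  have hM0 : ENNReal.ofReal m ≠ 0 := by simpa using hm0
  have hMt : ENNReal.ofReal m ≠ ⊤ := ENNReal.ofReal_ne_top
  have hmean := mean_eq hS h0 hm0 hmd
  set M := ENNReal.ofReal m with hM
  set θ := τ ^ p with hθ
  set lam := τ ^ (p + 1) with hlam
  have hτ0 : 0 < τ := by linarith
  have hlam0 : 0 < lam := by positivity
  obtain ⟨s, hs⟩ : ∃ s : ℕ, m ≤ (m - lam) * τ ^ ((p + 1) * p * s) := by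
    obtain ⟨s, hs⟩ := pow_unbounded_of_one_lt (m / (m - lam)) hτ
    refine ⟨s, ?_⟩
    have h1 : τ ^ s ≤ τ ^ ((p + 1) * p * s) := by
      apply pow_le_pow_right₀ hτ.le
      nlinarith [Nat.zero_le s, Nat.zero_le (p * s), Nat.mul_le_mul hp hp]
    have h2 : m / (m - lam) ≤ τ ^ ((p + 1) * p * s) := hs.le.trans h1
    rwa [div_le_iff₀' (by linarith)] at h2
  -- comparison of the factors
  have hcomp : ∀ i t, bet GW V M θ ((p + 1) * i + t) ≤
      Bx GW V (ENNReal.ofReal ((m - lam) * lam ^ (p * (i + s) + t))) / M := by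
    intro i t
    unfold bet
    refine ENNReal.div_le_div_right (Bx_mono ?_) _
    rw [hM, ← ENNReal.ofReal_mul hm0.le]
    apply ENNReal.ofReal_le_ofReal
    have e1 : θ ^ ((p + 1) * i + t) = τ ^ (p * ((p + 1) * i + t)) := by rw [hθ, ← pow_mul]
    have e2 : lam ^ (p * (i + s) + t) =
        τ ^ ((p + 1) * p * s) * (τ ^ (p * ((p + 1) * i + t)) * τ ^ t) := by
      rw [hlam, ← pow_mul, ← pow_add, ← pow_add]
      congr 1
      ring
    rw [e1, e2]
    have h3 : (1 : ℝ) ≤ τ ^ t := one_le_pow₀ hτ.le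
    have h4 : 0 < τ ^ (p * ((p + 1) * i + t)) := by positivity
    calc m * τ ^ (p * ((p + 1) * i + t))
        ≤ ((m - lam) * τ ^ ((p + 1) * p * s)) * (τ ^ (p * ((p + 1) * i + t)) * τ ^ t) := by
          apply mul_le_mul hs _ h4.le (hm0.le.trans hs)
          exact le_mul_of_one_le_right h4.le h3
      _ = _ := by ring
  set A := Lx GW V (ENNReal.ofReal (lam ^ (p * (i0 + s)))) with hA
  have hblock : ∀ N, Lx GW V (ENNReal.ofReal (lam ^ (p * (i0 + s + N)))) *
      ∏ k ∈ Finset.range ((p + 1) * N), bet GW V M θ ((p + 1) * i0 + k) ≤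
      A * ∏ i ∈ Finset.range N, bet GW V M θ ((p + 1) * (i0 + i) + p) := by
    intro N
    induction N with
    | zero => simp [hA]
    | succ N ih =>
      have hL := L_iter hm0 hS hV hrec lam hlam0 hτm (p * (i0 + s + N))
        (fun t => bet GW V M θ ((p + 1) * (i0 + N) + t)) p (fun u _ => by
          have := hcomp (i0 + N) u
          rwa [show i0 + N + s = i0 + s + N by omega] at this)
      rw [show (p + 1) * (N + 1) = (p + 1) * N + (p + 1) by ring, Finset.prod_range_add,
        Finset.prod_range_succ (fun x => bet GW V M θ ((p + 1) * i0 + ((p + 1) * N + x))),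
        Finset.prod_range_succ (fun i => bet GW V M θ ((p + 1) * (i0 + i) + p)),
        show p * (i0 + s + (N + 1)) = p * (i0 + s + N) + p by ring]
      have e : ∀ x, (p + 1) * i0 + ((p + 1) * N + x) = (p + 1) * (i0 + N) + x := fun x => by ring
      simp only [e]
      calc _ = (Lx GW V (ENNReal.ofReal (lam ^ (p * (i0 + s + N) + p))) *
            ∏ t ∈ Finset.range p, bet GW V M θ ((p + 1) * (i0 + N) + t)) *
            (∏ k ∈ Finset.range ((p + 1) * N), bet GW V M θ ((p + 1) * i0 + k)) *
            bet GW V M θ ((p + 1) * (i0 + N) + p) := by ring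
        _ ≤ Lx GW V (ENNReal.ofReal (lam ^ (p * (i0 + s + N)))) *
            (∏ k ∈ Finset.range ((p + 1) * N), bet GW V M θ ((p + 1) * i0 + k)) *
            bet GW V M θ ((p + 1) * (i0 + N) + p) := by gcongr
        _ ≤ (A * ∏ i ∈ Finset.range N, bet GW V M θ ((p + 1) * (i0 + i) + p)) *
            bet GW V M θ ((p + 1) * (i0 + N) + p) := by gcongr
        _ = _ := by ring
  have hE : ∀ N, (∫⁻ ω, Dr V (thr θ ((p + 1) * i0)) ((p + 1) * (N + s)) ω ∂GW) /
      M ^ ((p + 1) * (N + s)) ≤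
      A * ∏ i ∈ Finset.range N, bet GW V M θ ((p + 1) * (i0 + i) + p) := by
    intro N
    refine le_trans (E_bound hS hV hM0 hMt hrec θ _ _) (le_trans ?_ (hblock N))
    refine mul_le_mul' (le_of_eq ?_) ?_
    · congr 2
      rw [hθ, hlam, ← pow_mul, ← pow_mul]
      congr 1
      ring
    · rw [show (p + 1) * (N + s) = (p + 1) * N + (p + 1) * s by ring, Finset.prod_range_add]
      refine mul_le_of_le_one_right' ?_
      exact Finset.prod_le_one' fun k _ => bet_le_one hm0 hV hmean θ _
  have hlim : Tendsto (fun N => A * ∏ i ∈ Finset.range N, bet GW V M θ ((p + 1) * (i0 + i) + p))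
      atTop (nhds 0) := by
    have h1 : Tendsto (fun N => ∏ i ∈ Finset.range N, bet GW V M θ ((p + 1) * (i0 + i) + p))
        atTop (nhds 0) := by
      have hρ : 1 < θ ^ (p + 1) := one_lt_pow₀ (one_lt_pow₀ hτ (by omega)) (by omega)
      have hG := Gx_sum hS hV h0 hpos hm0 hmd hX (m * θ ^ ((p + 1) * i0 + p)) (θ ^ (p + 1))
        (by positivity) hρ
      have hBG : ∀ i : ℕ, Bx GW V (ENNReal.ofReal (m * θ ^ ((p + 1) * i0 + p) * (θ ^ (p + 1)) ^ i))
          + Gx GW V (ENNReal.ofReal (m * θ ^ ((p + 1) * i0 + p) * (θ ^ (p + 1)) ^ i)) = M :=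
        fun i => by rw [BG hV, hmean]
      have := prod_zero _ _ M hM0 hMt hBG hG
      refine this.congr fun N => Finset.prod_congr rfl fun i _ => ?_
      unfold bet
      congr 2
      rw [hM, ← ENNReal.ofReal_mul hm0.le, mul_assoc, ← pow_mul θ (p + 1) i, ← pow_add]
      congr 3
      ring
    have := ENNReal.Tendsto.const_mul h1 (Or.inr (Lx_fin (V := V) hS (lam ^ (p * (i0 + s)))))
    rwa [mul_zero] at this
  have hmeas : ∀ n, Measurable (fun ω => Dr V (thr θ ((p + 1) * i0)) n ω / M ^ n) := fun n =>
    (meas_Dr hV n _).div_const _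
  have hint : ∫⁻ ω, ⨅ n, Dr V (thr θ ((p + 1) * i0)) n ω / M ^ n ∂GW = 0 := by
    rw [← nonpos_iff_eq_zero]
    refine ge_of_tendsto' hlim fun N => le_trans ?_ (hE N)
    rw [div_eq_mul_inv, ← lintegral_mul_const _ (meas_Dr hV _ _)]
    refine lintegral_mono fun ω => ?_
    exact iInf_le_of_le ((p + 1) * (N + s)) le_rfl
  exact (lintegral_eq_zero_iff (Measurable.iInf hmeas)).1 hint

end part4

section part5
open scoped ENNReal

def shfs (u : List ℕ) (ω : Config) : Config := fun v => ω (u ++ v)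

lemma shfs_nil (ω : Config) : shfs [] ω = ω := rfl

lemma shfs_cons (i : ℕ) (u : List ℕ) (ω : Config) : shfs (i :: u) ω = shfs u (shf i ω) := rfl

lemma shfs_concat (i : ℕ) (u : List ℕ) (ω : Config) : shfs (u ++ [i]) ω = shf i (shfs u ω) := by
  funext v; simp [shfs, shf]

lemma shfs_root (u : List ℕ) (ω : Config) : shfs u ω [] = ω u := by simp [shfs]

lemma shfs_mp {GW : Measure Config} {q : ℕ → ℝ} (hS : Str GW q) (u : List ℕ) :
    MeasurePreserving (shfs u) GW GW := by
  induction u with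
  | nil => exact MeasurePreserving.id GW
  | cons i u ih => exact ih.comp (hS.shift i)

lemma memTree_nil (ω : Config) : memTree ω [] := fun k h => absurd h (Nat.not_lt_zero k)

lemma memTree_cons (ω : Config) (i : ℕ) (v : List ℕ) :
    memTree ω (i :: v) ↔ i < ω [] ∧ memTree (shf i ω) v := by
  constructor
  · intro h
    refine ⟨by simpa using h 0 (by simp), fun k hk => ?_⟩
    simpa [shf] using h (k + 1) (by simpa using hk)
  · rintro ⟨h1, h2⟩ k hk
    cases k with
    | zero => simpa using h1
    | succ k => simpa [shf] using h2 k (by simpa using hk)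

lemma memTree_append (u v : List ℕ) : ∀ ω : Config,
    memTree ω (u ++ v) ↔ memTree ω u ∧ memTree (shfs u ω) v := by
  induction u with
  | nil => intro ω; simp [memTree_nil, shfs_nil]
  | cons i u ih =>
    intro ω
    rw [List.cons_append, memTree_cons, memTree_cons, ih, shfs_cons, and_assoc]

lemma memTree_concat (ω : Config) (u : List ℕ) (i : ℕ) :
    memTree ω (u ++ [i]) ↔ memTree ω u ∧ i < ω u := by
  rw [memTree_append, memTree_cons, shfs_root]
  simp [memTree_nil]

lemma Z_shfs (ω : Config) (u : List ℕ) (hu : memTree ω u) (k : ℕ) :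
    Z ω u k = Z (shfs u ω) [] k := by
  unfold Z
  simp only [memTree_append, hu, true_and, shfs_nil, memTree_nil]

def lvlEquiv (ω : Config) (k : ℕ) :
    {v : List ℕ // v.length = k + 1 ∧ memTree ω v} ≃
      (Σ i : Fin (ω []), {v : List ℕ // v.length = k ∧ memTree (shf i ω) v}) where
  toFun v := match v with
    | ⟨[], h⟩ => absurd h.1 (by simp)
    | ⟨i :: w, h⟩ => ⟨⟨i, ((memTree_cons ω i w).1 h.2).1⟩,
        ⟨w, by simpa using h.1, ((memTree_cons ω i w).1 h.2).2⟩⟩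
  invFun x := ⟨x.1.1 :: x.2.1, by simpa using x.2.2.1, (memTree_cons _ _ _).2 ⟨x.1.2, x.2.2.2⟩⟩
  left_inv v := by
    rcases v with ⟨_ | ⟨i, w⟩, h⟩
    · exact absurd h.1 (by simp)
    · rfl
  right_inv x := rfl

lemma lvl_finite (k : ℕ) : ∀ ω : Config, Finite {v : List ℕ // v.length = k ∧ memTree ω v} := by
  induction k with
  | zero =>
    intro ω
    have : Subsingleton {v : List ℕ // v.length = 0 ∧ memTree ω v} := by
      constructor
      rintro ⟨a, ha⟩ ⟨b, hb⟩
      simp only [List.length_eq_zero_iff] at ha hb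
      simp [ha.1, hb.1]
    infer_instance
  | succ k ih =>
    intro ω
    have := fun i : Fin (ω []) => ih (shf i ω)
    exact Finite.of_equiv _ (lvlEquiv ω k).symm

lemma Z_nil (ω : Config) (k : ℕ) :
    Z ω [] k = Nat.card {v : List ℕ // v.length = k ∧ memTree ω v} := rfl

lemma Z_succ (ω : Config) (k : ℕ) :
    Z ω [] (k + 1) = ∑ i ∈ Finset.range (ω []), Z (shf i ω) [] k := by
  have := fun i : Fin (ω []) => lvl_finite k (shf i ω)
  rw [Z_nil, Nat.card_congr (lvlEquiv ω k), Nat.card_sigma, Finset.sum_range]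
  rfl

lemma sum_range_eq_tsum (n : ℕ) (f : ℕ → ℝ≥0∞) :
    ∑ i ∈ Finset.range n, f i = ∑' i, if i < n then f i else 0 := by
  rw [tsum_eq_sum (s := Finset.range n) (by intro i hi; rw [if_neg (by simpa using hi)])]
  exact Finset.sum_congr rfl fun i hi => by rw [if_pos (Finset.mem_range.1 hi)]

lemma meas_Z (k : ℕ) : Measurable (fun ω : Config => (Z ω [] k : ℝ≥0∞)) := by
  induction k with
  | zero =>
    have : ∀ ω : Config, Z ω [] 0 = 1 := by
      intro ω
      rw [Z_nil, Nat.card_eq_one_iff_unique]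
      refine ⟨⟨?_⟩, ⟨[], rfl, memTree_nil ω⟩⟩
      rintro ⟨a, ha⟩ ⟨b, hb⟩
      simp only [List.length_eq_zero_iff] at ha hb
      simp [ha.1, hb.1]
    simp only [this]
    exact measurable_const
  | succ k ih =>
    simp only [Z_succ, Nat.cast_sum, sum_range_eq_tsum]
    refine Measurable.tsum fun j => ?_
    exact Measurable.ite (meas_lt j) (ih.comp (measurable_shf j)) measurable_const

def Vc (c : ℕ → ℝ) (ω : Config) : ℝ≥0∞ :=
  limsup (fun k => (Z ω [] k : ℝ≥0∞) / ENNReal.ofReal (c k)) atTop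

lemma meas_Vc (c : ℕ → ℝ) : Measurable (Vc c) :=
  Measurable.limsup fun k => (meas_Z k).div_const _

lemma Vc_eq (c : ℕ → ℝ) (hc : ∀ n, 0 < c n) (ω : Config) (u : List ℕ) (hu : memTree ω u) (w : ℝ)
    (h : Tendsto (fun k => (Z ω u k : ℝ) / c k) atTop (nhds w)) :
    Vc c (shfs u ω) = ENNReal.ofReal w := by
  refine Tendsto.limsup_eq ?_
  refine (ENNReal.tendsto_ofReal h).congr fun k => ?_
  rw [ENNReal.ofReal_div_of_pos (hc k), ENNReal.ofReal_natCast, Z_shfs ω u hu]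

lemma W_rec (c : ℕ → ℝ) (hc : ∀ n, 0 < c n) {m : ℝ}
    (hr : Tendsto (fun n => c (n + 1) / c n) atTop (nhds m)) (ω : Config) (g : List ℕ → ℝ)
    (hg : ∀ u, memTree ω u → Tendsto (fun k => (Z ω u k : ℝ) / c k) atTop (nhds (g u)))
    (u : List ℕ) (hu : memTree ω u) :
    m * g u = ∑ i ∈ Finset.range (ω u), g (u ++ [i]) := by
  have h1 := hr.mul ((tendsto_add_atTop_iff_nat 1).2 (hg u hu))
  have h2 := tendsto_finsetSum (Finset.range (ω u)) (fun i hi =>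
    hg (u ++ [i]) ((memTree_concat ω u i).2 ⟨hu, Finset.mem_range.1 hi⟩))
  refine tendsto_nhds_unique h1 (h2.congr fun k => ?_)
  rw [Z_shfs ω u hu, Z_succ, shfs_root, Nat.cast_sum]
  have hk := (hc k).ne'
  have hk1 := (hc (k + 1)).ne'
  rw [div_mul_div_comm, mul_comm (c k), mul_div_mul_left _ _ hk1, Finset.sum_div]
  refine Finset.sum_congr rfl fun i hi => ?_
  rw [Z_shfs ω (u ++ [i]) ((memTree_concat ω u i).2 ⟨hu, Finset.mem_range.1 hi⟩), shfs_concat]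

lemma ray_succ (r : ℕ → ℕ) (n : ℕ) : rayVertex r (n + 1) = rayVertex r n ++ [r n] := by
  unfold rayVertex
  rw [List.ofFn_succ_last]
  simp

lemma ray_len (r : ℕ → ℕ) (n : ℕ) : (rayVertex r n).length = n := by simp [rayVertex]

lemma meas_ray (n : ℕ) (P : List ℕ → Prop) : MeasurableSet {r : ℕ → ℕ | P (rayVertex r n)} := by
  have h1 : Measurable (fun (r : ℕ → ℕ) (i : Fin n) => r i) :=
    measurable_pi_iff.2 fun i => measurable_pi_apply _
  exact h1 (Set.to_countable {x : Fin n → ℕ | P (List.ofFn x)}).measurableSet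

section unif
variable {ω : Config} {U : Measure (ℕ → ℕ)} [IsProbabilityMeasure U] {g : List ℕ → ℝ} {m : ℝ}

lemma unif_supp (hm : 1 < m) (hpos : ∀ u, memTree ω u → 0 < g u)
    (hrec : ∀ u, memTree ω u → m * g u = ∑ i ∈ Finset.range (ω u), g (u ++ [i]))
    (hU : ∀ u, memTree ω u →
      U {r | rayVertex r u.length = u} = ENNReal.ofReal ((m ^ u.length)⁻¹ * g u / g []))
    (n : ℕ) : ∀ᵐ r ∂U, memTree ω (rayVertex r n) := by
  have hg0 := hpos [] (memTree_nil ω)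
  have hm0 : 0 < m := by linarith
  induction n with
  | zero =>
    refine Eventually.of_forall fun r => ?_
    simpa [rayVertex] using memTree_nil ω
  | succ n ih =>
    have key : ∀ u : List ℕ, memTree ω u → u.length = n →
        ∀ᵐ r ∂U, rayVertex r n = u → r n < ω u := by
      intro u hu hun
      have hsub : (⋃ i ∈ Finset.range (ω u), {r : ℕ → ℕ | rayVertex r (n + 1) = u ++ [i]})
          ⊆ {r | rayVertex r n = u} := by
        intro r hr
        simp only [mem_iUnion, mem_ofPred_eq] at hr
        obtain ⟨i, _, hi⟩ := hr
        rw [ray_succ] at hi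
        exact (List.append_inj hi (by simp [ray_len, hun])).1
      have hmeas : MeasurableSet
          (⋃ i ∈ Finset.range (ω u), {r : ℕ → ℕ | rayVertex r (n + 1) = u ++ [i]}) :=
        Finset.measurableSet_biUnion _ fun i _ => meas_ray (n + 1) (fun v => v = u ++ [i])
      have hUu : U (⋃ i ∈ Finset.range (ω u), {r : ℕ → ℕ | rayVertex r (n + 1) = u ++ [i]})
          = U {r | rayVertex r n = u} := by
        rw [measure_biUnion_finset]
        · have h1 : ∀ i ∈ Finset.range (ω u), U {r : ℕ → ℕ | rayVertex r (n + 1) = u ++ [i]}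
              = ENNReal.ofReal ((m ^ (n + 1))⁻¹ * g (u ++ [i]) / g []) := by
            intro i hi
            have := hU (u ++ [i]) ((memTree_concat ω u i).2 ⟨hu, Finset.mem_range.1 hi⟩)
            simpa [hun] using this
          rw [Finset.sum_congr rfl h1, ← ENNReal.ofReal_sum_of_nonneg]
          · have h2 := hU u hu
            rw [hun] at h2
            rw [h2, ← Finset.sum_div, ← Finset.mul_sum, ← hrec u hu]
            congr 2
            field_simp
            ring
          · intro i hi
            have := hpos _ ((memTree_concat ω u i).2 ⟨hu, Finset.mem_range.1 hi⟩)
            positivity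
        · intro i _ j _ hij
          refine Set.disjoint_left.2 fun r hr hr' => hij ?_
          simp only [mem_ofPred_eq] at hr hr'
          rw [hr] at hr'
          simpa using hr'
        · exact fun i _ => meas_ray (n + 1) (fun v => v = u ++ [i])
      have hd := measure_sdiff hsub hmeas.nullMeasurableSet (measure_ne_top U _)
      rw [hUu, tsub_self] at hd
      rw [ae_iff]
      refine measure_mono_null ?_ hd
      intro r hr
      simp only [mem_ofPred_eq, Classical.not_imp] at hr
      refine ⟨hr.1, fun h => hr.2 ?_⟩
      simp only [mem_iUnion, mem_ofPred_eq] at h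
      obtain ⟨i, hi, hi'⟩ := h
      rw [ray_succ, hr.1] at hi'
      have : r n = i := by simpa using hi'
      rw [this]
      exact Finset.mem_range.1 hi
    have key2 : ∀ᵐ r ∂U, ∀ u : List ℕ, memTree ω u → u.length = n →
        rayVertex r n = u → r n < ω u := by
      rw [ae_all_iff]
      intro u
      by_cases h1 : memTree ω u
      · by_cases h2 : u.length = n
        · filter_upwards [key u h1 h2] with r hr _ _ using hr
        · exact Eventually.of_forall fun r _ h => absurd h h2
      · exact Eventually.of_forall fun r h => absurd h h1
    filter_upwards [ih, key2] with r h1 h2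
    rw [ray_succ, memTree_concat]
    exact ⟨h1, h2 _ h1 (ray_len r n) rfl⟩

lemma unif_Dr (hm : 1 < m) (V : Config → ℝ≥0∞) (hpos : ∀ u, memTree ω u → 0 < g u)
    (hV : ∀ u, memTree ω u → V (shfs u ω) = ENNReal.ofReal (g u))
    (hU : ∀ u, memTree ω u →
      U {r | rayVertex r u.length = u} = ENNReal.ofReal ((m ^ u.length)⁻¹ * g u / g []))
    (n : ℕ) : ∀ (u : List ℕ) (t : ℕ → ℝ≥0∞), memTree ω u →
    U {r | rayVertex r u.length = u ∧ ∀ j ≤ n, memTree ω (rayVertex r (u.length + j)) ∧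
        V (shfs (rayVertex r (u.length + j)) ω) < t j}
      ≤ Dr V t n (shfs u ω) * ENNReal.ofReal (1 / (m ^ (u.length + n) * g [])) := by
  have hg0 := hpos [] (memTree_nil ω)
  have hm0 : 0 < m := by linarith
  induction n with
  | zero =>
    intro u t hu
    simp only [Dr]
    split_ifs with h
    · rw [hV u hu, ← ENNReal.ofReal_mul (hpos u hu).le]
      refine le_trans (measure_mono (t := {r | rayVertex r u.length = u}) (fun r hr => hr.1)) (le_of_eq ?_)
      rw [hU u hu]
      congr 1
      simp only [add_zero]
      field_simp
    · rw [zero_mul, nonpos_iff_eq_zero]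
      refine measure_mono_null ?_ (measure_empty (μ := U))
      rintro r ⟨h1, h2⟩
      have := (h2 0 le_rfl).2
      rw [add_zero, h1] at this
      exact h this
  | succ n ih =>
    intro u t hu
    simp only [Dr]
    split_ifs with h
    · rw [← sum_range_eq_tsum, Finset.sum_mul, shfs_root]
      refine le_trans (measure_mono (t := ⋃ i ∈ Finset.range (ω u),
        {r | rayVertex r (u ++ [i]).length = u ++ [i] ∧
          ∀ j ≤ n, memTree ω (rayVertex r ((u ++ [i]).length + j)) ∧
          V (shfs (rayVertex r ((u ++ [i]).length + j)) ω) < t (j + 1)}) ?_)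
        (le_trans (measure_biUnion_finset_le _ _) (Finset.sum_le_sum fun i hi => ?_))
      · rintro r ⟨h1, h2⟩
        have hmem := (h2 1 (by omega)).1
        rw [ray_succ, h1, memTree_concat] at hmem
        simp only [mem_iUnion, mem_ofPred_eq]
        refine ⟨r u.length, Finset.mem_range.2 hmem.2, ?_, ?_⟩
        · rw [List.length_append, List.length_singleton, ray_succ, h1]
        · intro j hj
          have := h2 (j + 1) (by omega)
          rw [List.length_append, List.length_singleton,
            show u.length + 1 + j = u.length + (j + 1) by omega]
          exact this
      · have := ih (u ++ [i]) (fun k => t (k + 1))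
          ((memTree_concat ω u i).2 ⟨hu, Finset.mem_range.1 hi⟩)
        rw [shfs_concat] at this
        refine le_trans this (le_of_eq ?_)
        rw [List.length_append, List.length_singleton,
            show u.length + 1 + n = u.length + (n + 1) by omega]
    · rw [zero_mul, nonpos_iff_eq_zero]
      refine measure_mono_null ?_ (measure_empty (μ := U))
      rintro r ⟨h1, h2⟩
      have := (h2 0 (Nat.zero_le _)).2
      rw [add_zero, h1] at this
      exact h this

lemma unif_freq (hm : 1 < m) (V : Config → ℝ≥0∞) (hpos : ∀ u, memTree ω u → 0 < g u)
    (hV : ∀ u, memTree ω u → V (shfs u ω) = ENNReal.ofReal (g u))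
    (hrec : ∀ u, memTree ω u → m * g u = ∑ i ∈ Finset.range (ω u), g (u ++ [i]))
    (hU : ∀ u, memTree ω u →
      U {r | rayVertex r u.length = u} = ENNReal.ofReal ((m ^ u.length)⁻¹ * g u / g []))
    (θ : ℝ) (P : ℕ)
    (hD : ∀ (i0 : ℕ) (u : List ℕ),
      ⨅ n, Dr V (thr θ ((P + 1) * i0)) n (shfs u ω) / ENNReal.ofReal m ^ n = 0) :
    ∀ᵐ r ∂U, ∃ᶠ n in atTop, θ ^ n ≤ g (rayVertex r n) := by
  have hg0 := hpos [] (memTree_nil ω)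
  have hm0 : 0 < m := by linarith
  have hM0 : ENNReal.ofReal m ≠ 0 := by simpa using hm0
  have key : ∀ᵐ r ∂U, ∀ (i0 : ℕ) (u : List ℕ), memTree ω u → u.length = (P + 1) * i0 →
      ¬ (rayVertex r u.length = u ∧ ∀ j, memTree ω (rayVertex r (u.length + j)) ∧
        V (shfs (rayVertex r (u.length + j)) ω) < thr θ ((P + 1) * i0) j) := by
    rw [ae_all_iff]
    intro i0
    rw [ae_all_iff]
    intro u
    by_cases h1 : memTree ω u
    swap
    · exact Eventually.of_forall fun r h => absurd h h1
    by_cases h2 : u.length = (P + 1) * i0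
    swap
    · exact Eventually.of_forall fun r _ h => absurd h h2
    have : ∀ᵐ r ∂U, ¬ (rayVertex r u.length = u ∧ ∀ j, memTree ω (rayVertex r (u.length + j)) ∧
        V (shfs (rayVertex r (u.length + j)) ω) < thr θ ((P + 1) * i0) j) := by
      rw [ae_iff]
      simp only [not_not]
      set K := ENNReal.ofReal (1 / (m ^ u.length * g [])) with hK
      have hbd : ∀ n, U {r | rayVertex r u.length = u ∧
          ∀ j, memTree ω (rayVertex r (u.length + j)) ∧
          V (shfs (rayVertex r (u.length + j)) ω) < thr θ ((P + 1) * i0) j}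
          ≤ Dr V (thr θ ((P + 1) * i0)) n (shfs u ω) / ENNReal.ofReal m ^ n * K := by
        intro n
        refine le_trans (measure_mono (fun r hr => ?_)) (le_trans
          (unif_Dr hm V hpos hV hU n u (thr θ ((P + 1) * i0)) h1) (le_of_eq ?_))
        · exact ⟨hr.1, fun j _ => hr.2 j⟩
        · have e : ENNReal.ofReal (1 / (m ^ (u.length + n) * g []))
              = (ENNReal.ofReal m ^ n)⁻¹ * K := by
            rw [hK, ← ENNReal.ofReal_pow hm0.le,
              ← ENNReal.ofReal_inv_of_pos (by positivity), ← ENNReal.ofReal_mul (by positivity)]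
            congr 1
            rw [pow_add]
            field_simp
          rw [e, ← mul_assoc, ← div_eq_mul_inv]
      have hK0 : K ≠ 0 := by
        rw [hK]
        exact (ENNReal.ofReal_pos.2 (by positivity)).ne'
      have := le_iInf hbd
      rw [← ENNReal.iInf_mul_of_ne hK0 ENNReal.ofReal_ne_top,
        hD i0 u, zero_mul, nonpos_iff_eq_zero] at this
      exact this
    filter_upwards [this] with r hr _ _ using hr
  filter_upwards [key, ae_all_iff.2 (unif_supp hm hpos hrec hU)] with r h1 h2
  rw [frequently_atTop]
  intro N
  by_contra hcon
  push Not at hcon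
  refine h1 N (rayVertex r ((P + 1) * N)) (h2 _) (ray_len _ _) ⟨by rw [ray_len], fun j => ?_⟩
  rw [ray_len]
  refine ⟨h2 _, ?_⟩
  rw [hV _ (h2 _)]
  have hlt := hcon ((P + 1) * N + j) (by nlinarith [Nat.zero_le (P * N)])
  exact (ENNReal.ofReal_lt_ofReal_iff ((hpos _ (h2 _)).trans hlt)).2 hlt

lemma unif_upper (hm : 1 < m) (hpos : ∀ u, memTree ω u → 0 < g u)
    (hU : ∀ u, memTree ω u →
      U {r | rayVertex r u.length = u} = ENNReal.ofReal ((m ^ u.length)⁻¹ * g u / g []))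
    (u : List ℕ) (hu : memTree ω u) : g u ≤ m ^ u.length * g [] := by
  have hg0 := hpos [] (memTree_nil ω)
  have hm0 : 0 < m := by linarith
  have h := prob_le_one (μ := U) (s := {r | rayVertex r u.length = u})
  rw [hU u hu, ENNReal.ofReal_le_one, div_le_one hg0, inv_mul_le_iff₀ (by positivity)] at h
  exact h

end unif

lemma limsup_final {m : ℝ} (hm : 1 < m) (w : ℕ → ℝ) (hw : ∀ n, 0 < w n) (A : ℝ) (hA : 0 < A)
    (hup : ∀ n, w n ≤ m ^ n * A)
    (hlow : ∀ p : ℕ, 1 ≤ p → ∃ᶠ n in atTop,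
      ((m ^ ((p : ℝ) / (p + 1) ^ 2)) ^ p) ^ n ≤ w n) :
    limsup (fun n : ℕ => (1 / (n : ℝ)) * Real.log (w n)) atTop = Real.log m := by
  have hm0 : 0 < m := by linarith
  have hev : ∀ᶠ n : ℕ in atTop, (1 / (n : ℝ)) * Real.log (w n)
      ≤ Real.log m + (1 / (n : ℝ)) * Real.log A := by
    filter_upwards [eventually_ge_atTop 1] with n hn
    have hn0 : (0 : ℝ) < n := by exact_mod_cast hn
    have h1 := Real.log_le_log (hw n) (hup n)
    rw [Real.log_mul (by positivity) hA.ne', Real.log_pow] at h1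
    calc (1 / (n : ℝ)) * Real.log (w n) ≤ (1 / (n : ℝ)) * (n * Real.log m + Real.log A) := by
          gcongr
      _ = _ := by field_simp
  have hlim : Tendsto (fun n : ℕ => Real.log m + (1 / (n : ℝ)) * Real.log A) atTop
      (nhds (Real.log m)) := by
    have := (tendsto_one_div_atTop_nhds_zero_nat (𝕜 := ℝ)).mul_const (Real.log A)
    simpa using this.const_add (Real.log m)
  have hfr : ∀ p : ℕ, 1 ≤ p → ∃ᶠ n : ℕ in atTop,
      ((p : ℝ) / (p + 1)) ^ 2 * Real.log m ≤ (1 / (n : ℝ)) * Real.log (w n) := by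
    intro p hp
    refine ((hlow p hp).and_eventually (eventually_ge_atTop 1)).mono ?_
    rintro n ⟨h, hn⟩
    have hn0 : (0 : ℝ) < n := by exact_mod_cast hn
    have h1 := Real.log_le_log (by positivity) h
    rw [Real.log_pow, Real.log_pow, Real.log_rpow hm0] at h1
    calc ((p : ℝ) / (p + 1)) ^ 2 * Real.log m
        = (1 / (n : ℝ)) * (n * (p * ((p : ℝ) / (p + 1) ^ 2 * Real.log m))) := by field_simp
      _ ≤ _ := by gcongr
  have hbdd : IsBoundedUnder (· ≤ ·) atTop (fun n : ℕ => (1 / (n : ℝ)) * Real.log (w n)) := by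
    obtain ⟨b, hb⟩ := hlim.isBoundedUnder_le
    refine ⟨b, ?_⟩
    rw [eventually_map] at hb ⊢
    filter_upwards [hev, hb] with n h1 h2 using h1.trans h2
  have hcob : IsCoboundedUnder (· ≤ ·) atTop (fun n : ℕ => (1 / (n : ℝ)) * Real.log (w n)) :=
    IsCoboundedUnder.of_frequently_ge (hfr 1 le_rfl)
  apply le_antisymm
  · calc _ ≤ limsup (fun n : ℕ => Real.log m + (1 / (n : ℝ)) * Real.log A) atTop :=
        limsup_le_limsup hev hcob hlim.isBoundedUnder_le
      _ = _ := hlim.limsup_eq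
  · have hl : Tendsto (fun p : ℕ => ((p : ℝ) / (p + 1)) ^ 2 * Real.log m) atTop
        (nhds (Real.log m)) := by
      have := ((tendsto_natCast_div_add_atTop (𝕜 := ℝ) 1).pow 2).mul_const (Real.log m)
      simpa using this
    refine le_of_tendsto hl ?_
    filter_upwards [eventually_ge_atTop 1] with p hp
    exact le_limsup_of_frequently_le (hfr p hp) hbdd

end part5

/-- Let `𝒯` be a Galton–Watson tree with offspring law `q` (`q 0 = 0`, mean `m ∈ (1,∞)`),
`c n` Seneta–Heyde constants, `W∞(u) = lim_k Z_k(u)/c_k` and `UNIF` the uniform measure on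
the boundary, characterized by `UNIF({r : r_n = u}) = m^{-n} W∞(u) / W∞(e)`. If
`E[ν ln ν] = ∞`, then for `GW`-a.e. tree, for `UNIF`-a.e. ray `r`,
`limsup_n (1/n) ln W∞(r_n) = ln m`. -/
theorem limsup_log_Winf_along_unif_ray
    (q : ℕ → ℝ) (hq_nonneg : ∀ ℓ, 0 ≤ q ℓ) (hq_zero : q 0 = 0) (hq_sum : ∑' ℓ, q ℓ = 1)
    (m : ℝ) (hm_def : m = ∑' ℓ : ℕ, (ℓ : ℝ) * q ℓ) (hm_one : 1 < m)
    (GW : Measure Config) (hGW : IsGW q GW)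
    (c : ℕ → ℝ) (hc_pos : ∀ n, 0 < c n)
    (hc_ratio : Filter.Tendsto (fun n => c (n + 1) / c n) Filter.atTop (nhds m))
    (Winf : Config → List ℕ → ℝ)
    (hWinf : ∀ᵐ ω ∂GW, ∀ u : List ℕ, memTree ω u →
      Filter.Tendsto (fun k => (Z ω u k : ℝ) / c k) Filter.atTop (nhds (Winf ω u)) ∧
        0 < Winf ω u)
    (UNIF : Config → Measure (ℕ → ℕ))
    (hUNIF_prob : ∀ᵐ ω ∂GW, IsProbabilityMeasure (UNIF ω))
    (hUNIF : ∀ᵐ ω ∂GW, ∀ u : List ℕ, memTree ω u →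
      UNIF ω {r | rayVertex r u.length = u}
        = ENNReal.ofReal ((m ^ u.length)⁻¹ * Winf ω u / Winf ω []))
    (hXlogX : ∑' ℓ : ℕ, ENNReal.ofReal (q ℓ * (ℓ : ℝ) * Real.log ℓ) = ⊤) :
    ∀ᵐ ω ∂GW, ∀ᵐ r ∂(UNIF ω),
      Filter.limsup (fun n : ℕ => (1 / (n : ℝ)) * Real.log (Winf ω (rayVertex r n)))
        Filter.atTop = Real.log m := by
  have hS := gw_str q hq_nonneg hq_sum GW hGW
  have hm0 : 0 < m := by linarith
  have hV : ∀ᵐ ω ∂GW, ∀ u : List ℕ, memTree ω u →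
      Vc c (shfs u ω) = ENNReal.ofReal (Winf ω u) := by
    filter_upwards [hWinf] with ω h u hu
    exact Vc_eq c hc_pos ω u hu _ (h u hu).1
  have hR : ∀ᵐ ω ∂GW, ∀ u : List ℕ, memTree ω u →
      m * Winf ω u = ∑ i ∈ Finset.range (ω u), Winf ω (u ++ [i]) := by
    filter_upwards [hWinf] with ω h u hu
    exact W_rec c hc_pos hc_ratio ω (Winf ω) (fun u hu => (h u hu).1) u hu
  have hrec : ∀ᵐ ω ∂GW, ENNReal.ofReal m * Vc c ω
      = ∑' i, if i < ω [] then Vc c (shf i ω) else 0 := by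
    filter_upwards [hWinf, hV, hR] with ω h1 h2 h3
    have e0 := h2 [] (memTree_nil ω)
    rw [shfs_nil] at e0
    rw [e0, ← ENNReal.ofReal_mul hm0.le, h3 [] (memTree_nil ω), ← sum_range_eq_tsum]
    have hmem : ∀ i ∈ Finset.range (ω []), memTree ω ([] ++ [i]) := fun i hi =>
      (memTree_concat ω [] i).2 ⟨memTree_nil ω, Finset.mem_range.1 hi⟩
    rw [ENNReal.ofReal_sum_of_nonneg (fun i hi => (h1 _ (hmem i hi)).2.le)]
    refine Finset.sum_congr rfl fun i hi => ?_
    rw [← h2 _ (hmem i hi)]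
    rfl
  have hpos : ∀ᵐ ω ∂GW, 0 < Vc c ω := by
    filter_upwards [hWinf, hV] with ω h1 h2
    have e0 := h2 [] (memTree_nil ω)
    rw [shfs_nil] at e0
    rw [e0]
    exact ENNReal.ofReal_pos.2 (h1 [] (memTree_nil ω)).2
  have hdec : ∀ᵐ ω ∂GW, ∀ (p : ℕ), 1 ≤ p → ∀ (i0 : ℕ) (u : List ℕ),
      ⨅ n, Dr (Vc c) (thr ((m ^ ((p : ℝ) / (p + 1) ^ 2)) ^ p) ((p + 1) * i0)) n (shfs u ω)
        / ENNReal.ofReal m ^ n = 0 := by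
    rw [ae_all_iff]
    intro p
    by_cases hp : 1 ≤ p
    swap
    · exact Eventually.of_forall fun ω h => absurd h hp
    have hp0 : (0 : ℝ) < p := by exact_mod_cast hp
    have hτ : 1 < m ^ ((p : ℝ) / (p + 1) ^ 2) := Real.one_lt_rpow hm_one (by positivity)
    have hτm : (m ^ ((p : ℝ) / (p + 1) ^ 2)) ^ (p + 1) < m := by
      rw [← Real.rpow_natCast, ← Real.rpow_mul hm0.le]
      conv_rhs => rw [← Real.rpow_one m]
      refine Real.rpow_lt_rpow_of_exponent_lt hm_one ?_
      push_cast
      rw [div_mul_eq_mul_div, div_lt_one (by positivity)]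
      nlinarith
    have : ∀ᵐ ω ∂GW, ∀ (i0 : ℕ) (u : List ℕ),
        ⨅ n, Dr (Vc c) (thr ((m ^ ((p : ℝ) / (p + 1) ^ 2)) ^ p) ((p + 1) * i0)) n (shfs u ω)
          / ENNReal.ofReal m ^ n = 0 := by
      rw [ae_all_iff]
      intro i0
      rw [ae_all_iff]
      intro u
      exact (shfs_mp hS u).quasiMeasurePreserving.ae
        (decay hm_one hS (meas_Vc c) hq_nonneg hrec hpos hm_def hXlogX p hp _ hτ hτm i0)
    filter_upwards [this] with ω h _ using h
  filter_upwards [hWinf, hUNIF_prob, hUNIF, hV, hR, hdec] with ω h1 h2 h3 h4 h5 h6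
  haveI := h2
  have hp1 : ∀ u, memTree ω u → 0 < Winf ω u := fun u hu => (h1 u hu).2
  have hfr : ∀ᵐ r ∂(UNIF ω), ∀ p : ℕ, 1 ≤ p → ∃ᶠ n in atTop,
      ((m ^ ((p : ℝ) / (p + 1) ^ 2)) ^ p) ^ n ≤ Winf ω (rayVertex r n) := by
    rw [ae_all_iff]
    intro p
    by_cases hp : 1 ≤ p
    swap
    · exact Eventually.of_forall fun ω h => absurd h hp
    filter_upwards [unif_freq hm_one (Vc c) hp1 h4 h5 h3 _ p (h6 p hp)] with r hr _ using hr
  filter_upwards [hfr, ae_all_iff.2 (unif_supp hm_one hp1 h5 h3)] with r hr1 hr2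
  refine limsup_final hm_one (fun n => Winf ω (rayVertex r n)) (fun n => hp1 _ (hr2 n))
    (Winf ω []) (hp1 [] (memTree_nil ω)) (fun n => ?_) hr1
  have := unif_upper hm_one hp1 h3 _ (hr2 n)
  rwa [ray_len] at this

end
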